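/- For β ∈ (0,1), there exists a constant C > 0 such that the tail of the Grünwald coefficients satisfies ∑_{j=ℓ}^{∞} |g_j^{(β)}| ≤ C · ℓ^{−β} for all ℓ ≥ 1; that is, the tail sum is O(ℓ^{−β}). -/

import Mathlib

/-- Grünwald coefficient `g_j^(s) = ((-1)^j / j!) * s(s-1)⋯(s-j+1)` (with `g_0 = 1`). -/
noncomputable def grunwald (s : ℝ) (j : ℕ) : ℝ :=
  (-1) ^ j / (Nat.factorial j : ℝ) * ∏ i ∈ Finset.range j, (s - i)

lemma grunwald_succ (s : ℝ) (j : ℕ) :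
    grunwald s (j + 1) = grunwald s j * ((j - s) / (j + 1)) := by
  have h : (j.factorial : ℝ) ≠ 0 := by positivity
  have h' : (j : ℝ) + 1 ≠ 0 := by positivity
  simp only [grunwald, Finset.prod_range_succ, Nat.factorial_succ, pow_succ]
  push_cast
  field_simp
  ring

lemma succ_mul_abs_grunwald_succ {s : ℝ} (hs : s ≤ 1) {j : ℕ} (hj : 1 ≤ j) :
    ((j : ℝ) + 1) * |grunwald s (j + 1)| = (j - s) * |grunwald s j| := by
  have hj' : (1 : ℝ) ≤ j := by exact_mod_cast hj
  have h : (0 : ℝ) ≤ (j - s) / (j + 1) := div_nonneg (by linarith) (by linarith)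
  rw [grunwald_succ, abs_mul, abs_of_nonneg h, mul_left_comm,
    mul_div_cancel₀ _ (by positivity), mul_comm]

lemma mul_sum_range_abs_grunwald {s : ℝ} (hs : s ≤ 1) {l : ℕ} (hl : 1 ≤ l) (n : ℕ) :
    s * ∑ j ∈ Finset.range n, |grunwald s (l + j)| =
      l * |grunwald s l| - (l + n : ℕ) * |grunwald s (l + n)| := by
  induction n with
  | zero => simp
  | succ n ih =>
    have h := succ_mul_abs_grunwald_succ hs (show 1 ≤ l + n by omega)
    rw [Finset.sum_range_succ, mul_add, ih, ← add_assoc, Nat.cast_succ, h]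
    ring

lemma one_sub_div_mul_rpow_succ_le {s x : ℝ} (hs : 0 ≤ s) (hs' : s ≤ 1) (hx : 1 ≤ x) :
    (1 - s / x) * (x + 1) ^ s ≤ x ^ s := by
  have hx0 : 0 < x := by linarith
  have hb : (1 + 1 / x) ^ s ≤ 1 + s * (1 / x) :=
    rpow_one_add_le_one_add_mul_self (by linarith [one_div_pos.2 hx0]) hs hs'
  have hsplit : (x + 1) ^ s = x ^ s * (1 + 1 / x) ^ s := by
    rw [← Real.mul_rpow hx0.le (by positivity)]
    congr 1
    field_simp
  have hnn : 0 ≤ 1 - s / x := sub_nonneg.2 ((div_le_one hx0).2 (by linarith))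
  have hprod : (1 - s / x) * (1 + 1 / x) ^ s ≤ 1 := by
    refine (mul_le_mul_of_nonneg_left hb hnn).trans ?_
    rw [mul_one_div]
    nlinarith [sq_nonneg (s / x)]
  rw [hsplit, mul_left_comm]
  exact mul_le_of_le_one_right (by positivity) hprod

lemma mul_abs_grunwald_mul_rpow_le {s : ℝ} (hs : 0 ≤ s) (hs' : s ≤ 1) {l : ℕ} (hl : 1 ≤ l) :
    l * |grunwald s l| * (l : ℝ) ^ s ≤ s := by
  induction l, hl using Nat.le_induction with
  | base => simp [grunwald, abs_of_nonneg hs]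
  | succ l hl ih =>
    have hl' : (1 : ℝ) ≤ l := by exact_mod_cast hl
    have hl0 : (l : ℝ) ≠ 0 := by positivity
    have h := succ_mul_abs_grunwald_succ hs' hl
    push_cast
    calc ((l : ℝ) + 1) * |grunwald s (l + 1)| * ((l : ℝ) + 1) ^ s
        = l * |grunwald s l| * ((1 - s / l) * ((l : ℝ) + 1) ^ s) := by
          rw [h]
          field_simp
      _ ≤ l * |grunwald s l| * (l : ℝ) ^ s :=
          mul_le_mul_of_nonneg_left (one_sub_div_mul_rpow_succ_le hs hs' hl') (by positivity)
      _ ≤ s := ih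

lemma sum_range_abs_grunwald_le {s : ℝ} (hs : 0 < s) (hs' : s ≤ 1) {l : ℕ} (hl : 1 ≤ l)
    (n : ℕ) : ∑ j ∈ Finset.range n, |grunwald s (l + j)| ≤ (l : ℝ) ^ (-s) := by
  have hl0 : (0 : ℝ) < l := by exact_mod_cast hl
  have h₁ := mul_sum_range_abs_grunwald hs' hl n
  have h₂ : l * |grunwald s l| ≤ s * (l : ℝ) ^ (-s) := by
    rw [Real.rpow_neg hl0.le, ← div_eq_mul_inv, le_div_iff₀ (by positivity)]
    exact mul_abs_grunwald_mul_rpow_le hs.le hs' hl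
  have h₃ : 0 ≤ ((l + n : ℕ) : ℝ) * |grunwald s (l + n)| := by positivity
  exact le_of_mul_le_mul_left (by linarith) hs

theorem stmt9 (β : ℝ) (hβ : β ∈ Set.Ioo (0 : ℝ) 1) :
    ∃ C : ℝ, 0 < C ∧ ∀ ℓ : ℕ, 1 ≤ ℓ →
      (Summable fun j : ℕ => |grunwald β (ℓ + j)|) ∧
      ∑' j : ℕ, |grunwald β (ℓ + j)| ≤ C * (ℓ : ℝ) ^ (-β) := by
  refine ⟨1, one_pos, fun ℓ hℓ => ?_⟩
  have h := sum_range_abs_grunwald_le hβ.1 hβ.2.le hℓ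
  rw [one_mul]
  exact ⟨summable_of_sum_range_le (fun _ => abs_nonneg _) h,
    Real.tsum_le_of_sum_range_le (fun _ => abs_nonneg _) h⟩
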